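/- For the β-biased random walk (β > 1) started at (d,1) on the trap with anchor (d,0), entrance length e and core length c, let T be the first hitting time of the anchor (d,0). Then P[T ≥ β^c] ≥ (β−1)² / (2β(β^{e+1}+β−2)). -/

import Mathlib

open MeasureTheory Filter
open scoped ENNReal

noncomputable section

/-- Vertices of the square lattice. -/
abbrev V : Type := ℤ × ℤ

/-- Adjacency in the square lattice ℤ²: Euclidean distance one. -/
def latAdj (u v : V) : Prop := (u.1 - v.1) ^ 2 + (u.2 - v.2) ^ 2 = 1

instance : MeasurableSpace (Sym2 V) := ⊤

open scoped Classical in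
/-- One-step transition probability of the β-biased random walk on the subgraph of ℤ²
with edge set `G`: if the set `Λ` of neighbours of `z` is nonempty and contains the right
neighbour `(z.1+1, z.2)`, step to it with probability `β/(β+|Λ|-1)` and to each other
neighbour with probability `1/(β+|Λ|-1)`; if `Λ` does not contain the right neighbour, step
uniformly in `Λ`; if `Λ` is empty, stay put. -/
def transProb (β : ℝ) (G : Set (Sym2 V)) (z w : V) : ℝ :=
  if {u : V | s(z, u) ∈ G} = ∅ then (if w = z then 1 else 0)
  else
    if s(z, w) ∈ G then
      (if s(z, ((z.1 + 1, z.2) : V)) ∈ G then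
        (if w = ((z.1 + 1, z.2) : V) then
          β / (β + ({u : V | s(z, u) ∈ G}.ncard : ℝ) - 1)
        else 1 / (β + ({u : V | s(z, u) ∈ G}.ncard : ℝ) - 1))
      else 1 / ({u : V | s(z, u) ∈ G}.ncard : ℝ))
    else 0

/-- `μ` is the law of the β-biased random walk on the subgraph of ℤ² with edge set `G`,
started at `z₀`: a probability measure on trajectories whose cylinder probabilities are
the products of the one-step transition probabilities. -/
def IsWalkLaw (β : ℝ) (G : Set (Sym2 V)) (z₀ : V) (μ : Measure (ℕ → V)) : Prop :=
  IsProbabilityMeasure μ ∧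
    ∀ (n : ℕ) (f : ℕ → V), f 0 = z₀ →
      μ {ω | ∀ i ≤ n, ω i = f i} =
        ENNReal.ofReal (∏ i ∈ Finset.range n, transProb β G (f i) (f (i + 1)))

/-- The trap with anchor `(d, y)`, entrance length `e` (at height `y+1`, running leftward
from the anchor) and core length `c` (at height `y+2`, running rightward). -/
def trapEdgesAt (d y : ℤ) (e c : ℕ) : Set (Sym2 V) :=
  {s((d, y), (d, y + 1)), s((d - e, y + 1), (d - e, y + 2))} ∪
    {f | ∃ i : ℕ, i < e ∧ f = s((d - e + i, y + 1), (d - e + i + 1, y + 1))} ∪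
    {f | ∃ i : ℕ, i < c ∧ f = s((d - e + i, y + 2), (d - e + i + 1, y + 2))}

/-- A subsolution of the backward equation of a chain killed at `a` bounds from below the
probability that the chain avoids `a` up to time `n`. The states carrying the subsolution are
parametrized by `p : ι → α`, and `S i` lists the successors of `p i` taken into account. -/
theorem avoid_prob_ge {α ι : Type*} [MeasurableSpace α] [MeasurableSingletonClass α]
    (μ : Measure (ℕ → α)) (K : α → α → ℝ) (hK : ∀ x y, 0 ≤ K x y) (a : α) (p : ι → α) (i₀ : ι)
    (hμ : ∀ (n : ℕ) (f : ℕ → α), f 0 = p i₀ →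
      μ {ω | ∀ i ≤ n, ω i = f i} =
        ENNReal.ofReal (∏ i ∈ Finset.range n, K (f i) (f (i + 1))))
    (H : ℕ → ι → ℝ) (S : ι → Finset ι) (hS : ∀ i, Set.InjOn p (S i))
    (h0 : ∀ i, H 0 i ≤ 1) (ha : ∀ n i, p i = a → H n i ≤ 0)
    (hH : ∀ n i, p i ≠ a → H (n + 1) i ≤ ∑ j ∈ S i, K (p i) (p j) * H n j) (n : ℕ) :
    ENNReal.ofReal (H n i₀) ≤ μ {ω | ∀ t ≤ n, ω t ≠ a} := by
  classical
  have hmeas : ∀ (m : ℕ) (x : α), MeasurableSet {ω : ℕ → α | ω m = x} := fun m x =>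
    (measurable_pi_apply (X := fun _ => α) m) (measurableSet_singleton x)
  have hcyl : ∀ (m n : ℕ) (f : ℕ → α), MeasurableSet
      {ω : ℕ → α | (∀ i ≤ m, ω i = f i) ∧ ∀ t, m ≤ t → t ≤ m + n → ω t ≠ a} := by
    intro m n f
    simp only [Set.ofPred_and, Set.ofPred_forall]
    refine MeasurableSet.inter ?_ ?_
    · exact MeasurableSet.iInter fun i => MeasurableSet.iInter fun _ => hmeas i _
    · exact MeasurableSet.iInter fun t => MeasurableSet.iInter fun _ =>
        MeasurableSet.iInter fun _ => (hmeas t a).compl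
  have key : ∀ (n m : ℕ) (f : ℕ → α) (i : ι), f 0 = p i₀ → f m = p i →
      ENNReal.ofReal ((∏ l ∈ Finset.range m, K (f l) (f (l + 1))) * H n i) ≤
        μ {ω | (∀ l ≤ m, ω l = f l) ∧ ∀ t, m ≤ t → t ≤ m + n → ω t ≠ a} := by
    intro n
    induction n with
    | zero =>
      intro m f i hf0 hfm
      have hP : 0 ≤ ∏ l ∈ Finset.range m, K (f l) (f (l + 1)) :=
        Finset.prod_nonneg fun _ _ => hK _ _
      by_cases hi : p i = a
      · rw [ENNReal.ofReal_of_nonpos (mul_nonpos_of_nonneg_of_nonpos hP (ha 0 i hi))]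
        exact zero_le
      · calc _ ≤ ENNReal.ofReal (∏ l ∈ Finset.range m, K (f l) (f (l + 1))) :=
              ENNReal.ofReal_le_ofReal (mul_le_of_le_one_right hP (h0 i))
          _ = _ := (hμ m f hf0).symm
          _ ≤ _ := by
              refine measure_mono fun ω hω => ⟨hω, fun t ht ht' => ?_⟩
              obtain rfl : t = m := by omega
              rw [hω t le_rfl, hfm]
              exact hi
    | succ n ih =>
      intro m f i hf0 hfm
      have hP : 0 ≤ ∏ l ∈ Finset.range m, K (f l) (f (l + 1)) :=
        Finset.prod_nonneg fun _ _ => hK _ _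
      by_cases hi : p i = a
      · rw [ENNReal.ofReal_of_nonpos (mul_nonpos_of_nonneg_of_nonpos hP (ha _ i hi))]
        exact zero_le
      let g : ι → ℕ → α := fun j => Function.update f (m + 1) (p j)
      let B : ι → Set (ℕ → α) := fun j =>
        {ω | (∀ l ≤ m + 1, ω l = g j l) ∧ ∀ t, m + 1 ≤ t → t ≤ m + 1 + n → ω t ≠ a}
      have hg : ∀ j, ∀ l ≤ m, g j l = f l := fun j l hl =>
        Function.update_of_ne (by omega) _ _
      have hg' : ∀ j, g j (m + 1) = p j := fun j => Function.update_self _ _ _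
      have hprod : ∀ j, ∏ l ∈ Finset.range (m + 1), K (g j l) (g j (l + 1)) =
          (∏ l ∈ Finset.range m, K (f l) (f (l + 1))) * K (p i) (p j) := by
        intro j
        rw [Finset.prod_range_succ, hg', hg j m le_rfl, hfm]
        congr 1
        refine Finset.prod_congr rfl fun l hl => ?_
        have := Finset.mem_range.1 hl
        rw [hg j l (by omega), hg j (l + 1) (by omega)]
      calc _ ≤ ENNReal.ofReal (∑ j ∈ S i,
              (∏ l ∈ Finset.range (m + 1), K (g j l) (g j (l + 1))) * H n j) := by
            refine ENNReal.ofReal_le_ofReal ?_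
            simp only [hprod, mul_assoc]
            rw [← Finset.mul_sum]
            exact mul_le_mul_of_nonneg_left (hH n i hi) hP
        _ ≤ ∑ j ∈ S i, ENNReal.ofReal
              ((∏ l ∈ Finset.range (m + 1), K (g j l) (g j (l + 1))) * H n j) :=
            Finset.le_sum_of_subadditive _ ENNReal.ofReal_zero.le (fun _ _ => ENNReal.ofReal_add_le)
              _ _
        _ ≤ ∑ j ∈ S i, μ (B j) := Finset.sum_le_sum fun j _ =>
            ih (m + 1) (g j) j ((hg j 0 (Nat.zero_le _)).trans hf0) (hg' j)
        _ = μ (⋃ j ∈ S i, B j) := by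
            refine (measure_biUnion_finset ?_ fun j _ => hcyl _ _ _).symm
            intro j hj k hk hjk
            refine Set.disjoint_left.2 fun ω hω hω' => hjk (hS i hj hk ?_)
            rw [← hg' j, ← hg' k, ← hω.1 _ le_rfl, ← hω'.1 _ le_rfl]
        _ ≤ _ := by
            refine measure_mono (Set.iUnion₂_subset fun j _ ω hω => ⟨fun l hl => ?_, ?_⟩)
            · rw [hω.1 l (by omega), hg j l hl]
            · intro t ht ht'
              rcases ht.eq_or_lt with rfl | ht
              · rw [hω.1 m (by omega), hg j m le_rfl, hfm]
                exact hi
              · exact hω.2 t ht (by omega)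
  refine (?_ : _ ≤ _).trans ((key n 0 (fun _ => p i₀) i₀ rfl rfl).trans (measure_mono ?_))
  · simp
  · intro ω hω t ht
    exact hω.2 t (Nat.zero_le _) (by omega)

theorem transProb_nonneg {β : ℝ} (hβ : 1 < β) (G : Set (Sym2 V)) (z w : V) :
    0 ≤ transProb β G z w := by
  have h : 0 ≤ β + ({u : V | s(z, u) ∈ G}.ncard : ℝ) - 1 := by
    have : (0 : ℝ) ≤ ({u : V | s(z, u) ∈ G}.ncard : ℝ) := Nat.cast_nonneg _
    linarith
  unfold transProb
  split_ifs <;> positivity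

theorem transProb_of_right {β : ℝ} {G : Set (Sym2 V)} {z b : V}
    (h : {u : V | s(z, u) ∈ G} = {(z.1 + 1, z.2), b}) (hb : b ≠ (z.1 + 1, z.2)) :
    transProb β G z (z.1 + 1, z.2) = β / (β + 1) ∧ transProb β G z b = 1 / (β + 1) := by
  have h1 : s(z, ((z.1 + 1, z.2) : V)) ∈ G := by
    have : ((z.1 + 1, z.2) : V) ∈ {u : V | s(z, u) ∈ G} := by rw [h]; simp
    exact this
  have h2 : s(z, b) ∈ G := by
    have : b ∈ {u : V | s(z, u) ∈ G} := by rw [h]; simp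
    exact this
  have hne : {u : V | s(z, u) ∈ G} ≠ ∅ := Set.Nonempty.ne_empty ⟨b, h2⟩
  have hc : β + ({u : V | s(z, u) ∈ G}.ncard : ℝ) - 1 = β + 1 := by
    rw [h, Set.ncard_pair hb.symm]; push_cast; ring
  simp only [transProb, if_neg hne, if_pos h1, if_pos h2, hc, if_neg hb, if_true, and_self]

theorem transProb_of_not_right {β : ℝ} {G : Set (Sym2 V)} {z w : V}
    (hw : s(z, w) ∈ G) (hr : s(z, ((z.1 + 1, z.2) : V)) ∉ G) :
    transProb β G z w = 1 / ({u : V | s(z, u) ∈ G}.ncard : ℝ) := by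
  have hne : {u : V | s(z, u) ∈ G} ≠ ∅ := Set.Nonempty.ne_empty ⟨w, hw⟩
  simp only [transProb, if_neg hne, if_pos hw, if_neg hr]

theorem mem_trapEdgesAt {d y x₁ y₁ x₂ y₂ : ℤ} {e c : ℕ} :
    s(((x₁, y₁) : V), ((x₂, y₂) : V)) ∈ trapEdgesAt d y e c ↔
      (x₁ = d ∧ x₂ = d ∧ (y₁ = y ∧ y₂ = y + 1 ∨ y₁ = y + 1 ∧ y₂ = y)) ∨
      (x₁ = d - e ∧ x₂ = d - e ∧ (y₁ = y + 1 ∧ y₂ = y + 2 ∨ y₁ = y + 2 ∧ y₂ = y + 1)) ∨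
      (y₁ = y + 1 ∧ y₂ = y + 1 ∧
        (x₂ = x₁ + 1 ∧ d - e ≤ x₁ ∧ x₁ < d ∨ x₁ = x₂ + 1 ∧ d - e ≤ x₂ ∧ x₂ < d)) ∨
      (y₁ = y + 2 ∧ y₂ = y + 2 ∧
        (x₂ = x₁ + 1 ∧ d - e ≤ x₁ ∧ x₁ < d - e + c ∨
          x₁ = x₂ + 1 ∧ d - e ≤ x₂ ∧ x₂ < d - e + c)) := by
  simp only [trapEdgesAt, Set.mem_union, Set.mem_insert_iff, Set.mem_singleton_iff,
    Set.mem_ofPred_eq, Sym2.eq_iff, Prod.mk.injEq]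
  constructor
  · rintro ((h | ⟨i, hi, h⟩) | ⟨i, hi, h⟩)
    · rcases h with (h | h) | (h | h)
      · exact Or.inl (by omega)
      · exact Or.inl (by omega)
      · exact Or.inr (Or.inl (by omega))
      · exact Or.inr (Or.inl (by omega))
    · exact Or.inr (Or.inr (Or.inl (by omega)))
    · exact Or.inr (Or.inr (Or.inr (by omega)))
  · rintro (h | h | ⟨h1, h2, h⟩ | ⟨h1, h2, h⟩)
    · exact Or.inl (Or.inl (Or.inl (by omega)))
    · exact Or.inl (Or.inl (Or.inr (by omega)))
    · left; right
      rcases h with h | h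
      · exact ⟨(x₁ - (d - e)).toNat, by omega, by omega⟩
      · exact ⟨(x₂ - (d - e)).toNat, by omega, by omega⟩
    · right
      rcases h with h | h
      · exact ⟨(x₁ - (d - e)).toNat, by omega, by omega⟩
      · exact ⟨(x₂ - (d - e)).toNat, by omega, by omega⟩
/-- The vertices of the trap with anchor `(d, 0)`, listed along the path from the anchor to the
end of the core. -/
def trapVertex (d : ℤ) (e k : ℕ) : V :=
  if k = 0 then (d, 0) else if k ≤ e + 1 then (d - k + 1, 1) else (d - 2 * e - 2 + k, 2)

theorem trapVertex_zero (d : ℤ) (e : ℕ) : trapVertex d e 0 = (d, 0) := rfl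

theorem trapVertex_entrance (d : ℤ) {e k : ℕ} (hk : 1 ≤ k) (hk' : k ≤ e + 1) :
    trapVertex d e k = (d - k + 1, 1) := by
  rw [trapVertex, if_neg (by omega), if_pos hk']

theorem trapVertex_core (d : ℤ) {e k : ℕ} (hk : e + 2 ≤ k) :
    trapVertex d e k = (d - 2 * e - 2 + k, 2) := by
  rw [trapVertex, if_neg (by omega), if_neg (by omega)]

theorem trapVertex_injective (d : ℤ) (e : ℕ) : Function.Injective (trapVertex d e) := by
  intro k l h
  unfold trapVertex at h
  split_ifs at h <;> simp only [Prod.mk.injEq] at h <;> omega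

theorem trapVertex_neighbors (d : ℤ) {e c k : ℕ} (he : 1 ≤ e) (hc : 1 ≤ c) (hk : 1 ≤ k)
    (hkN : k < e + 2 + c) :
    {u : V | s(trapVertex d e k, u) ∈ trapEdgesAt d 0 e c} =
      {trapVertex d e (k - 1), trapVertex d e (k + 1)} := by
  ext ⟨x, y⟩
  rw [Set.mem_ofPred_eq, Set.mem_insert_iff, Set.mem_singleton_iff]
  obtain ⟨l, rfl⟩ : ∃ l, k = l + 1 := ⟨k - 1, by omega⟩
  rw [Nat.add_sub_cancel]
  rcases (by omega : l = 0 ∨ (1 ≤ l ∧ l < e) ∨ l = e ∨ l = e + 1 ∨ e + 2 ≤ l) with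
    rfl | ⟨h1, h2⟩ | rfl | rfl | h1
  · rw [trapVertex_zero, trapVertex_entrance d le_rfl (by omega),
      trapVertex_entrance d (by omega) (by omega), mem_trapEdgesAt, Prod.mk.injEq, Prod.mk.injEq]
    omega
  · rw [trapVertex_entrance d (k := l + 1) (by omega) (by omega),
      trapVertex_entrance d (k := l) (by omega) (by omega),
      trapVertex_entrance d (by omega) (by omega), mem_trapEdgesAt, Prod.mk.injEq, Prod.mk.injEq]
    omega
  · rw [trapVertex_entrance d (k := l + 1) (by omega) (by omega),
      trapVertex_entrance d (k := l) (by omega) (by omega),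
      trapVertex_core d (by omega), mem_trapEdgesAt, Prod.mk.injEq, Prod.mk.injEq]
    omega
  · rw [trapVertex_core d (k := e + 1 + 1) (by omega),
      trapVertex_entrance d (k := e + 1) (by omega) (by omega),
      trapVertex_core d (by omega), mem_trapEdgesAt, Prod.mk.injEq, Prod.mk.injEq]
    omega
  · rw [trapVertex_core d (k := l + 1) (by omega), trapVertex_core d (k := l) (by omega),
      trapVertex_core d (by omega), mem_trapEdgesAt, Prod.mk.injEq, Prod.mk.injEq]
    omega

theorem trapVertex_neighbors_last (d : ℤ) {e c : ℕ} (hc : 1 ≤ c) :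
    {u : V | s(trapVertex d e (e + 2 + c), u) ∈ trapEdgesAt d 0 e c} =
      {trapVertex d e (e + 1 + c)} := by
  ext ⟨x, y⟩
  rw [Set.mem_ofPred_eq, Set.mem_singleton_iff, trapVertex_core d (by omega),
    trapVertex_core d (by omega), mem_trapEdgesAt, Prod.mk.injEq]
  omega

theorem transProb_trap_start (β : ℝ) (d : ℤ) {e c : ℕ} (he : 1 ≤ e) (hc : 1 ≤ c) :
    transProb β (trapEdgesAt d 0 e c) (trapVertex d e 1) (trapVertex d e 0) = 1 / 2 ∧
    transProb β (trapEdgesAt d 0 e c) (trapVertex d e 1) (trapVertex d e 2) = 1 / 2 := by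
  have hn := trapVertex_neighbors d he hc (le_refl 1) (by omega : 1 < e + 2 + c)
  have hcard : ({u : V | s(trapVertex d e 1, u) ∈ trapEdgesAt d 0 e c}.ncard : ℝ) = 2 := by
    rw [hn, Set.ncard_pair ((trapVertex_injective d e).ne (by omega))]
    norm_num
  have hr : s(trapVertex d e 1, (((trapVertex d e 1).1 + 1, (trapVertex d e 1).2) : V)) ∉
      trapEdgesAt d 0 e c := by
    rw [trapVertex_entrance d le_rfl (by omega), mem_trapEdgesAt]
    omega
  have hm : ∀ w ∈ ({trapVertex d e (1 - 1), trapVertex d e (1 + 1)} : Set V),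
      s(trapVertex d e 1, w) ∈ trapEdgesAt d 0 e c := fun w hw => hn.symm.subset hw
  rw [← hcard]
  exact ⟨transProb_of_not_right (hm _ (by simp)) hr, transProb_of_not_right (hm _ (by simp)) hr⟩

theorem transProb_trap_entrance (β : ℝ) (d : ℤ) {e c k : ℕ} (he : 1 ≤ e) (hc : 1 ≤ c)
    (hk : 2 ≤ k) (hk' : k ≤ e + 1) :
    transProb β (trapEdgesAt d 0 e c) (trapVertex d e k) (trapVertex d e (k - 1)) =
      β / (β + 1) ∧
    transProb β (trapEdgesAt d 0 e c) (trapVertex d e k) (trapVertex d e (k + 1)) =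
      1 / (β + 1) := by
  have hn := trapVertex_neighbors d he hc (by omega : 1 ≤ k) (by omega : k < e + 2 + c)
  have hr : trapVertex d e (k - 1) = ((trapVertex d e k).1 + 1, (trapVertex d e k).2) := by
    rw [trapVertex_entrance d (k := k - 1) (by omega) (by omega),
      trapVertex_entrance d (by omega) hk', Prod.mk.injEq]
    omega
  have hne : trapVertex d e (k + 1) ≠ trapVertex d e (k - 1) :=
    (trapVertex_injective d e).ne (by omega)
  rw [hr] at hn hne ⊢
  exact transProb_of_right hn hne

theorem transProb_trap_core (β : ℝ) (d : ℤ) {e c k : ℕ} (he : 1 ≤ e) (hc : 1 ≤ c)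
    (hk : e + 2 ≤ k) (hk' : k < e + 2 + c) :
    transProb β (trapEdgesAt d 0 e c) (trapVertex d e k) (trapVertex d e (k - 1)) =
      1 / (β + 1) ∧
    transProb β (trapEdgesAt d 0 e c) (trapVertex d e k) (trapVertex d e (k + 1)) =
      β / (β + 1) := by
  have hn := trapVertex_neighbors d he hc (by omega : 1 ≤ k) hk'
  have hr : trapVertex d e (k + 1) = ((trapVertex d e k).1 + 1, (trapVertex d e k).2) := by
    rw [trapVertex_core d (k := k + 1) (by omega), trapVertex_core d hk, Prod.mk.injEq]
    omega
  have hne : trapVertex d e (k - 1) ≠ trapVertex d e (k + 1) :=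
    (trapVertex_injective d e).ne (by omega)
  rw [Set.pair_comm] at hn
  rw [hr] at hn hne ⊢
  exact (transProb_of_right hn hne).symm

theorem transProb_trap_last (β : ℝ) (d : ℤ) {e c : ℕ} (hc : 1 ≤ c) :
    transProb β (trapEdgesAt d 0 e c) (trapVertex d e (e + 2 + c)) (trapVertex d e (e + 1 + c)) =
      1 := by
  have hn := trapVertex_neighbors_last d (e := e) hc
  have hr : s(trapVertex d e (e + 2 + c),
      (((trapVertex d e (e + 2 + c)).1 + 1, (trapVertex d e (e + 2 + c)).2) : V)) ∉
      trapEdgesAt d 0 e c := by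
    rw [trapVertex_core d (by omega), mem_trapEdgesAt]
    omega
  have hm : s(trapVertex d e (e + 2 + c), trapVertex d e (e + 1 + c)) ∈ trapEdgesAt d 0 e c :=
    hn.symm.subset rfl
  rw [transProb_of_not_right hm hr, hn, Set.ncard_singleton]
  norm_num

/-- The resistance of the edge of the trap joining the vertices of index `k` and `k + 1`. -/
def trapResistance (β : ℝ) (e k : ℕ) : ℝ :=
  if k = 0 then 1 else if k ≤ e + 1 then β ^ (k - 1) else β ^ e / β ^ (k - e - 1)

/-- The resistance of the trap between the anchor and the vertex of index `k`. -/
def trapPotential (β : ℝ) (e k : ℕ) : ℝ :=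
  ∑ i ∈ Finset.range k, trapResistance β e i

theorem trapResistance_pos {β : ℝ} (hβ : 1 < β) (e k : ℕ) : 0 < trapResistance β e k := by
  unfold trapResistance
  split_ifs <;> positivity

theorem trapResistance_entrance (β : ℝ) {e k : ℕ} (hk : k ≤ e) :
    trapResistance β e (k + 1) = β ^ k := by
  rw [trapResistance, if_neg k.succ_ne_zero, if_pos (by omega), Nat.add_sub_cancel]

theorem trapResistance_core (β : ℝ) (e j : ℕ) :
    trapResistance β e (e + 1 + j) = β ^ e / β ^ j := by
  rcases Nat.eq_zero_or_pos j with rfl | hj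
  · rw [add_zero, trapResistance_entrance β le_rfl, pow_zero, div_one]
  · rw [trapResistance, if_neg (by omega), if_neg (by omega), show e + 1 + j - e - 1 = j by omega]

theorem trapPotential_succ (β : ℝ) (e k : ℕ) :
    trapPotential β e (k + 1) = trapPotential β e k + trapResistance β e k :=
  Finset.sum_range_succ _ _

theorem trapPotential_mono {β : ℝ} (hβ : 1 < β) (e : ℕ) : Monotone (trapPotential β e) :=
  monotone_nat_of_le_succ fun k => by
    rw [trapPotential_succ]
    exact le_add_of_nonneg_right (trapResistance_pos hβ e k).le

theorem trapPotential_harmonic {β : ℝ} (hβ : 1 < β) (d : ℤ) {e c k : ℕ} (he : 1 ≤ e)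
    (hc : 1 ≤ c) (hk : 1 ≤ k) (hkN : k < e + 2 + c) :
    trapPotential β e k =
      transProb β (trapEdgesAt d 0 e c) (trapVertex d e k) (trapVertex d e (k - 1)) *
        trapPotential β e (k - 1) +
      transProb β (trapEdgesAt d 0 e c) (trapVertex d e k) (trapVertex d e (k + 1)) *
        trapPotential β e (k + 1) := by
  have hβ0 : β ≠ 0 := by positivity
  have hβ1 : β + 1 ≠ 0 := by positivity
  obtain ⟨l, rfl⟩ : ∃ l, k = l + 1 := ⟨k - 1, by omega⟩
  rw [Nat.add_sub_cancel, trapPotential_succ, trapPotential_succ, trapPotential_succ]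
  rcases (by omega : l = 0 ∨ (1 ≤ l ∧ l ≤ e) ∨ e + 1 ≤ l) with rfl | ⟨h1, h2⟩ | h1
  · obtain ⟨ha, hb⟩ := transProb_trap_start β d he hc
    rw [zero_add, ha, hb]
    have h1 : trapResistance β e 0 = 1 := by simp [trapResistance]
    have h2 : trapResistance β e 1 = 1 := by simp [trapResistance]
    rw [h1, h2]
    ring
  · obtain ⟨ha, hb⟩ := transProb_trap_entrance β d he hc (k := l + 1) (by omega) (by omega)
    rw [Nat.add_sub_cancel] at ha
    have hs : trapResistance β e (l + 1) = β * trapResistance β e l := by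
      obtain ⟨m, rfl⟩ : ∃ m, l = m + 1 := ⟨l - 1, by omega⟩
      rw [trapResistance_entrance β (by omega), trapResistance_entrance β (by omega), pow_succ']
    rw [ha, hb, hs]
    field_simp
    ring
  · obtain ⟨ha, hb⟩ := transProb_trap_core β d he hc (k := l + 1) (by omega) (by omega)
    rw [Nat.add_sub_cancel] at ha
    have hs : trapResistance β e l = β * trapResistance β e (l + 1) := by
      obtain ⟨m, rfl⟩ : ∃ m, l = e + 1 + m := ⟨l - e - 1, by omega⟩
      rw [add_assoc (e + 1) m 1, trapResistance_core, trapResistance_core, pow_succ]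
      field_simp
    rw [ha, hb, hs]
    field_simp
    ring

theorem trapPotential_entrance (β : ℝ) {e k : ℕ} (hk : k ≤ e + 1) :
    (β - 1) * trapPotential β e (k + 1) = β ^ k + β - 2 := by
  induction k with
  | zero => simp [trapPotential, trapResistance]; ring
  | succ k ih =>
    rw [trapPotential_succ, mul_add, ih (by omega), trapResistance_entrance β (by omega)]
    ring

theorem trapPotential_core {β : ℝ} (hβ : 1 < β) (e j : ℕ) :
    (β - 1) * trapPotential β e (e + 2 + j) = β ^ (e + 1) + β - 2 + (β ^ e - β ^ e / β ^ j) := by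
  have hβ0 : β ≠ 0 := by positivity
  induction j with
  | zero => rw [add_zero, trapPotential_entrance β le_rfl]; simp
  | succ j ih =>
    rw [← add_assoc, trapPotential_succ, mul_add, ih, show e + 2 + j = e + 1 + (j + 1) by omega,
      trapResistance_core]
    field_simp
    ring

/-- A lower bound for the probability that the walk on the trap started at the vertex of index
`k` avoids the anchor for `n` steps: the probability of reaching the end of the core first,
times the probability of returning there on each of the at most `(n + 1) / 2` later excursions
from it. -/
def trapStay (β : ℝ) (e c n k : ℕ) : ℝ :=
  trapPotential β e k / trapPotential β e (e + 2 + c) *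
    (trapPotential β e (e + 1 + c) / trapPotential β e (e + 2 + c)) ^
      ((n + (e + 2 + c + k + 1) % 2) / 2)

theorem stay_prob_ge {β : ℝ} (hβ : 1 < β) (d : ℤ) {e c : ℕ} (he : 1 ≤ e) (hc : 1 ≤ c)
    {μ : Measure (ℕ → V)} (hμ : IsWalkLaw β (trapEdgesAt d 0 e c) ((d, 1) : V) μ) (n : ℕ) :
    ENNReal.ofReal (trapStay β e c n 1) ≤ μ {ω | ∀ t ≤ n, ω t ≠ ((d, 0) : V)} := by
  have h0 : trapPotential β e 0 = 0 := by simp [trapPotential]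
  have hnn : ∀ k, 0 ≤ trapPotential β e k := fun k => h0 ▸ trapPotential_mono hβ e k.zero_le
  have hNpos : 0 < trapPotential β e (e + 2 + c) := by
    have := trapResistance_pos hβ e (e + 1 + c)
    have := hnn (e + 1 + c)
    rw [show e + 2 + c = e + 1 + c + 1 by omega, trapPotential_succ]
    linarith
  set N := e + 2 + c with hN
  set q := trapPotential β e (e + 1 + c) / trapPotential β e N with hq
  have hq0 : 0 ≤ q := div_nonneg (hnn _) (hnn _)
  have hq1 : q ≤ 1 := (div_le_one hNpos).2 (trapPotential_mono hβ e (by omega))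
  have hstart : trapVertex d e 1 = (d, 1) := by simp [trapVertex]
  let p : {k // k ≤ N} → V := fun k => trapVertex d e k
  let S : {k // k ≤ N} → Finset {k // k ≤ N} := fun k =>
    if h : k.1 < N then {⟨k.1 - 1, by omega⟩, ⟨k.1 + 1, h⟩} else {⟨e + 1 + c, by omega⟩}
  refine avoid_prob_ge μ (transProb β (trapEdgesAt d 0 e c)) (transProb_nonneg hβ _) (d, 0)
    p ⟨1, by omega⟩ (fun n f hf => hμ.2 n f (hf.trans hstart))
    (fun n k => trapStay β e c n k) S ?_ ?_ ?_ ?_ n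
  · exact fun i => ((trapVertex_injective d e).comp Subtype.val_injective).injOn
  · intro k
    exact mul_le_one₀ ((div_le_one hNpos).2 (trapPotential_mono hβ e k.2)) (pow_nonneg hq0 _)
      (pow_le_one₀ hq0 hq1)
  · intro n k hk
    have : k.1 = 0 := trapVertex_injective d e (hk.trans (by simp [trapVertex]))
    simp [trapStay, this, h0]
  · intro n k hk
    have hk0 : 1 ≤ k.1 := by
      by_contra h
      exact hk (by simp [p, trapVertex, show k.1 = 0 by omega])
    by_cases hkN : k.1 < N
    · have hne : (⟨k.1 - 1, by omega⟩ : {k // k ≤ N}) ≠ ⟨k.1 + 1, hkN⟩ := by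
        simp only [ne_eq, Subtype.mk.injEq]; omega
      simp only [S, dif_pos hkN, Finset.sum_pair hne, p]
      have hharm := trapPotential_harmonic hβ d he hc hk0 hkN
      simp only [trapStay, ← hN, ← hq]
      have hexp : (N + (k.1 - 1) + 1) % 2 = (N + (k.1 + 1) + 1) % 2 := by omega
      rw [hexp]
      have hpow : q ^ ((n + 1 + (N + k.1 + 1) % 2) / 2) ≤
          q ^ ((n + (N + (k.1 + 1) + 1) % 2) / 2) :=
        pow_le_pow_of_le_one hq0 hq1 (by omega)
      refine (mul_le_mul_of_nonneg_left hpow (div_nonneg (hnn _) (hnn _))).trans_eq ?_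
      rw [hharm]
      ring
    · have hkN' : k.1 = N := le_antisymm k.2 (by omega)
      have hlast := transProb_trap_last β d (e := e) hc
      simp only [S, dif_neg hkN, Finset.sum_singleton, p, hkN']
      rw [hN, hlast]
      simp only [trapStay, ← hN, ← hq]
      rw [div_self hNpos.ne', one_mul, one_mul, ← pow_succ']
      exact (congrArg (q ^ ·) (by omega)).le

theorem le_trapStay {β : ℝ} (hβ : 1 < β) {e c n : ℕ} (hc : 1 ≤ c) (hn : (n : ℝ) ≤ β ^ c) :
    (β - 1) ^ 2 / (2 * β * (β ^ (e + 1) + β - 2)) ≤ trapStay β e c n 1 := by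
  have hβ0 : 0 < β := by positivity
  have h1 : trapPotential β e 1 = 1 := by simp [trapPotential, trapResistance]
  have hpe : 1 ≤ β ^ e := one_le_pow₀ hβ.le
  have hpc : 0 < β ^ c := by positivity
  have hsucc : trapPotential β e (e + 2 + c) =
      trapPotential β e (e + 1 + c) + β ^ e / β ^ c := by
    rw [← trapResistance_core, ← trapPotential_succ]
    congr 1
    omega
  have hge : β ^ e ≤ trapPotential β e (e + 1 + c) := by
    rw [← trapResistance_entrance β le_rfl]
    exact Finset.single_le_sum (fun i _ => (trapResistance_pos hβ e i).le)
      (Finset.mem_range.2 (by omega))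
  have hcore := trapPotential_core hβ e c
  have hfrac : 0 < β ^ e / β ^ c := by positivity
  set R := trapPotential β e (e + 2 + c)
  set Q := trapPotential β e (e + 1 + c)
  have hR : 0 < R := by linarith
  set m := (n + (e + 2 + c + 1 + 1) % 2) / 2
  have hm' : 2 * (m : ℝ) ≤ β ^ c + 1 := by
    have : 2 * m ≤ n + 1 := by omega
    have : 2 * (m : ℝ) ≤ n + 1 := by exact_mod_cast this
    linarith
  have hpow : 1 / 2 ≤ (Q / R) ^ m := by
    have hQ : Q / R = 1 + -(β ^ e / β ^ c / R) := by
      rw [show Q = R - β ^ e / β ^ c by linarith, sub_div, div_self hR.ne']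
      ring
    have hle : β ^ e / β ^ c / R ≤ 1 := by
      rw [div_le_one hR]
      linarith
    have hb := one_add_mul_le_pow (a := -(β ^ e / β ^ c / R)) (by linarith) m
    have hmul : 2 * (m : ℝ) * (β ^ e / β ^ c / R) ≤ 1 := by
      calc 2 * (m : ℝ) * (β ^ e / β ^ c / R) ≤ (β ^ c + 1) * (β ^ e / β ^ c / R) := by gcongr
        _ = (β ^ e + β ^ e / β ^ c) / R := by field_simp
        _ ≤ 1 := by
            rw [div_le_one hR]
            linarith
    rw [hQ]
    linarith
  have hB : (β - 1) * β ^ e ≤ β ^ (e + 1) + β - 2 := by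
    rw [pow_succ]
    linarith
  have hBpos : 0 < β ^ (e + 1) + β - 2 := lt_of_lt_of_le (by nlinarith) hB
  have hRle : (β - 1) ^ 2 / (2 * β * (β ^ (e + 1) + β - 2)) ≤ 1 / R * (1 / 2) := by
    rw [div_mul_div_comm, div_le_div_iff₀ (by positivity) (by positivity)]
    have : (β - 1) * ((β - 1) * R) ≤ (β - 1) * (β ^ (e + 1) + β - 2 + β ^ e) :=
      mul_le_mul_of_nonneg_left (by linarith) (by linarith)
    nlinarith
  refine hRle.trans ?_
  simp only [trapStay]
  rw [h1]
  exact mul_le_mul_of_nonneg_left hpow (by positivity)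

/-- Lemma 2.3. For the β-biased walk started at `(d,1)` on the trap with anchor `(d,0)`,
entrance length `e` and core length `c`, the first hitting time `T` of the anchor satisfies
`P[T ≥ β^c] ≥ (β-1)²/(2β(β^{e+1}+β-2))` (the event `T ≥ β^c` being that the anchor is not
visited at any time `t < β^c`). -/
theorem stay_in_core (β : ℝ) (hβ : 1 < β) (d : ℤ) (e c : ℕ) (he : 1 ≤ e) (hc : 1 ≤ c)
    (μ : Measure (ℕ → V)) (hμ : IsWalkLaw β (trapEdgesAt d 0 e c) ((d, 1) : V) μ) :
    ENNReal.ofReal ((β - 1) ^ 2 / (2 * β * (β ^ (e + 1) + β - 2))) ≤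
      μ {ω | ∀ t : ℕ, (t : ℝ) < β ^ c → ω t ≠ ((d, 0) : V)} := by
  refine (ENNReal.ofReal_le_ofReal
    (le_trapStay hβ hc (Nat.floor_le (by positivity : 0 ≤ β ^ c)))).trans
    ((stay_prob_ge hβ d he hc hμ _).trans (measure_mono fun ω hω t ht => ?_))
  exact hω t (Nat.le_floor ht.le)

end
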